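/- Let n > 0 and τ > 0 be real, let μ₀ = ∫ (x² − τ/n)_+ dN(0, 1/n)(x), and define B(θ) = ∫ (x² − τ/n)_+ dN(θ, 1/n)(x) − μ₀ − θ². Then for every θ ∈ ℝ, B is differentiable at θ with derivative B′(θ) = (2/√n)[φ(τ^{1/2} − n^{1/2}θ) − φ(τ^{1/2} + n^{1/2}θ)] − 2θ[Φ(τ^{1/2} − n^{1/2}θ) − Φ(−τ^{1/2} − n^{1/2}θ)]. -/

import Mathlib

open MeasureTheory ProbabilityTheory Real
open scoped NNReal ENNReal

/-- The standard normal density φ. -/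
noncomputable def stdNormalPDF (x : ℝ) : ℝ :=
  (Real.sqrt (2 * π))⁻¹ * Real.exp (-x ^ 2 / 2)

/-- The standard normal cumulative distribution function Φ. -/
noncomputable def stdNormalCDF (x : ℝ) : ℝ := (gaussianReal 0 1 (Set.Iic x)).toReal

/-- The bias function `B(θ) = E_θ (X² - τ/n)₊ - μ₀ - θ²`, where `X ~ N(θ, 1/n)` and
`μ₀ = E_0 (X² - τ/n)₊`. -/
noncomputable def biasFn (n τ : ℝ) (θ : ℝ) : ℝ :=
  (∫ x, max (x ^ 2 - τ / n) 0 ∂(gaussianReal θ (Real.toNNReal (1 / n))))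
    - (∫ x, max (x ^ 2 - τ / n) 0 ∂(gaussianReal 0 (Real.toNNReal (1 / n))))
    - θ ^ 2

lemma stdNormalPDF_eq_gaussianPDFReal (x : ℝ) : stdNormalPDF x = gaussianPDFReal 0 1 x := by
  simp [stdNormalPDF, gaussianPDFReal]

lemma stdNormalPDF_neg (x : ℝ) : stdNormalPDF (-x) = stdNormalPDF x := by
  simp [stdNormalPDF]

lemma hasDerivAt_stdNormalPDF (x : ℝ) :
    HasDerivAt stdNormalPDF (-x * stdNormalPDF x) x := by
  have h : HasDerivAt (fun y : ℝ ↦ -y ^ 2 / 2) (-x) x :=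
    (((hasDerivAt_id x).pow 2).neg.div_const 2).congr_deriv (by simp; ring)
  exact (h.exp.const_mul (√(2 * π))⁻¹).congr_deriv (by simp only [stdNormalPDF]; ring)

lemma continuous_stdNormalPDF : Continuous stdNormalPDF :=
  continuous_iff_continuousAt.2 fun x ↦ (hasDerivAt_stdNormalPDF x).continuousAt

lemma integrable_stdNormalPDF : Integrable stdNormalPDF :=
  (integrable_gaussianPDFReal 0 1).congr
    (.of_forall fun x ↦ (stdNormalPDF_eq_gaussianPDFReal x).symm)

lemma stdNormalCDF_eq_integral (x : ℝ) :
    stdNormalCDF x = ∫ y in Set.Iic x, stdNormalPDF y := by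
  simp_rw [stdNormalPDF_eq_gaussianPDFReal]
  rw [stdNormalCDF, gaussianReal_apply_eq_integral 0 one_ne_zero,
    ENNReal.toReal_ofReal (integral_nonneg fun y ↦ gaussianPDFReal_nonneg 0 1 y)]

lemma hasDerivAt_stdNormalCDF (x : ℝ) : HasDerivAt stdNormalCDF (stdNormalPDF x) x := by
  have h : stdNormalCDF = fun y ↦ (∫ z in (0 : ℝ)..y, stdNormalPDF z) + stdNormalCDF 0 := by
    ext y
    rw [stdNormalCDF_eq_integral, stdNormalCDF_eq_integral,
      ← intervalIntegral.integral_Iic_sub_Iic integrable_stdNormalPDF.integrableOn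
        integrable_stdNormalPDF.integrableOn, sub_add_cancel]
  rw [h]
  exact (intervalIntegral.integral_hasDerivAt_right
    (continuous_stdNormalPDF.intervalIntegrable _ _)
    (continuous_stdNormalPDF.stronglyMeasurableAtFilter _ _)
    continuous_stdNormalPDF.continuousAt).add_const _

lemma integrable_sq_gaussianReal (m : ℝ) (v : ℝ≥0) :
    Integrable (fun x ↦ x ^ 2) (gaussianReal m v) :=
  (memLp_id_gaussianReal (μ := m) (v := v) 2).integrable_sq

lemma integral_sq_gaussianReal (m : ℝ) (v : ℝ≥0) :
    ∫ x, x ^ 2 ∂(gaussianReal m v) = m ^ 2 + v := by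
  have h := variance_eq_sub (memLp_id_gaussianReal (μ := m) (v := v) 2)
  simp only [variance_id_gaussianReal, Pi.pow_apply, id_eq, integral_id_gaussianReal] at h
  linarith

lemma integral_gaussianReal_eq_integral_stdNormalPDF {s : ℝ} (hs : 0 < s) (m : ℝ)
    {f : ℝ → ℝ} (hf : Continuous f) :
    ∫ x, f x ∂(gaussianReal m (Real.toNNReal (1 / s ^ 2)))
      = ∫ z, stdNormalPDF z * f (m + z / s) := by
  have hv : gaussianReal m (Real.toNNReal (1 / s ^ 2))
      = (gaussianReal 0 1).map (fun z ↦ m + z / s) := by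
    have h1 := gaussianReal_map_const_mul (μ := 0) (v := 1) s⁻¹
    have h2 := gaussianReal_map_const_add (μ := s⁻¹ * 0)
      (v := NNReal.mk (s⁻¹ ^ 2) (sq_nonneg _) * 1) m
    rw [← h1, Measure.map_map (by fun_prop) (by fun_prop)] at h2
    have h3 : ((m + ·) ∘ (s⁻¹ * ·) : ℝ → ℝ) = fun z ↦ m + z / s := by
      ext z; simp [div_eq_inv_mul]
    rw [h3] at h2
    rw [h2]
    congr 1
    · simp
    · ext
      rw [Real.coe_toNNReal _ (by positivity)]
      simp
  rw [hv, integral_map (by fun_prop) hf.aestronglyMeasurable,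
    integral_gaussianReal_eq_integral_smul one_ne_zero]
  simp_rw [stdNormalPDF_eq_gaussianPDFReal, smul_eq_mul]

/-- A primitive of `z ↦ (r² / s² - (m + z / s)²) φ(z)`. -/
noncomputable def truncatedPrimitive (r s m z : ℝ) : ℝ :=
  (r ^ 2 / s ^ 2 - m ^ 2 - 1 / s ^ 2) * stdNormalCDF z + 2 * m / s * stdNormalPDF z
    + z * stdNormalPDF z / s ^ 2

lemma hasDerivAt_truncatedPrimitive (r s m z : ℝ) :
    HasDerivAt (truncatedPrimitive r s m)
      (stdNormalPDF z * (r ^ 2 / s ^ 2 - (m + z / s) ^ 2)) z := by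
  have h := (((hasDerivAt_stdNormalCDF z).const_mul (r ^ 2 / s ^ 2 - m ^ 2 - 1 / s ^ 2)).add
    ((hasDerivAt_stdNormalPDF z).const_mul (2 * m / s))).add
    (((hasDerivAt_id z).mul (hasDerivAt_stdNormalPDF z)).div_const (s ^ 2))
  exact h.congr_deriv (by simp only [id_eq]; ring)

lemma integral_truncated_gaussianReal {r s : ℝ} (hr : 0 < r) (hs : 0 < s) (m : ℝ) :
    ∫ x, max (r ^ 2 / s ^ 2 - x ^ 2) 0 ∂(gaussianReal m (Real.toNNReal (1 / s ^ 2)))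
      = truncatedPrimitive r s m (r - s * m) - truncatedPrimitive r s m (-r - s * m) := by
  have hle : -r - s * m ≤ r - s * m := by linarith
  have hfac (z : ℝ) : r ^ 2 / s ^ 2 - (m + z / s) ^ 2
      = (r - s * m - z) * (z - (-r - s * m)) / s ^ 2 := by
    field_simp
    ring
  rw [integral_gaussianReal_eq_integral_stdNormalPDF hs m (by fun_prop),
    ← intervalIntegral.integral_eq_sub_of_hasDerivAt
      (fun z _ ↦ hasDerivAt_truncatedPrimitive r s m z)
      (Continuous.intervalIntegrable (continuous_stdNormalPDF.mul (by fun_prop)) _ _),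
    intervalIntegral.integral_of_le hle, ← integral_indicator measurableSet_Ioc]
  congr 1
  ext z
  by_cases hz : z ∈ Set.Ioc (-r - s * m) (r - s * m)
  · rw [Set.indicator_of_mem hz, max_eq_left]
    rw [hfac]
    exact div_nonneg (mul_nonneg (by linarith [hz.2]) (by linarith [hz.1])) (sq_nonneg s)
  · rw [Set.indicator_of_notMem hz, max_eq_right, mul_zero]
    rw [hfac]
    refine div_nonpos_of_nonpos_of_nonneg ?_ (sq_nonneg s)
    rw [Set.mem_Ioc, not_and_or, not_lt, not_le] at hz
    rcases hz with hz | hz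
    · exact mul_nonpos_of_nonneg_of_nonpos (by linarith) (by linarith)
    · exact mul_nonpos_of_nonpos_of_nonneg (by linarith) (by linarith)

lemma integral_max_sq_sub_gaussianReal (c m : ℝ) (v : ℝ≥0) :
    ∫ x, max (x ^ 2 - c) 0 ∂(gaussianReal m v)
      = m ^ 2 + v - c + ∫ x, max (c - x ^ 2) 0 ∂(gaussianReal m v) := by
  have hsq := integrable_sq_gaussianReal m v
  have hmax (x : ℝ) : max (x ^ 2 - c) 0 = (x ^ 2 - c) + max (c - x ^ 2) 0 := by
    rcases le_total (x ^ 2) c with h | h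
    · rw [max_eq_right (by linarith), max_eq_left (by linarith)]; ring
    · rw [max_eq_left (by linarith), max_eq_right (by linarith)]; ring
  have hsub : Integrable (fun x ↦ x ^ 2 - c) (gaussianReal m v) := hsq.sub (integrable_const c)
  have hpos : Integrable (fun x ↦ max (c - x ^ 2) 0) (gaussianReal m v) :=
    ((integrable_const c).sub hsq).pos_part
  simp_rw [hmax]
  rw [integral_add hsub hpos,
    integral_sub hsq (integrable_const c), integral_sq_gaussianReal]
  simp

lemma hasDerivAt_truncatedPrimitive_comp (r s a : ℝ) (hs : 0 < s) (ha : a ^ 2 = r ^ 2) (t : ℝ) :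
    HasDerivAt (fun m ↦ truncatedPrimitive r s m (a - s * m))
      (2 / s * stdNormalPDF (a - s * t) - 2 * t * stdNormalCDF (a - s * t)) t := by
  have hz : HasDerivAt (fun m ↦ a - s * m) (-s) t :=
    (((hasDerivAt_id t).const_mul s).const_sub a).congr_deriv (by simp)
  have hΦ := (hasDerivAt_stdNormalCDF (a - s * t)).comp t hz
  have hφ := (hasDerivAt_stdNormalPDF (a - s * t)).comp t hz
  have hc : HasDerivAt (fun m : ℝ ↦ r ^ 2 / s ^ 2 - m ^ 2 - 1 / s ^ 2) (-(2 * t)) t :=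
    ((((hasDerivAt_id t).pow 2).const_sub _).sub_const _).congr_deriv (by simp)
  have hl : HasDerivAt (fun m : ℝ ↦ 2 * m / s) (2 / s) t :=
    (((hasDerivAt_id t).const_mul 2).div_const s).congr_deriv (by simp)
  refine (((hc.mul hΦ).add (hl.mul hφ)).add ((hz.mul hφ).div_const (s ^ 2))).congr_deriv ?_
  simp only [Function.comp_apply]
  rw [← ha]
  field_simp
  ring

/-- the derivative of the bias function:
`B'(θ) = (2/√n)[φ(√τ - √n θ) - φ(√τ + √n θ)] - 2θ[Φ(√τ - √n θ) - Φ(-√τ - √n θ)]`. -/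
theorem hasDerivAt_biasFn (n τ : ℝ) (hn : 0 < n) (hτ : 0 < τ) (θ : ℝ) :
    HasDerivAt (biasFn n τ)
      ((2 / Real.sqrt n) *
          (stdNormalPDF (Real.sqrt τ - Real.sqrt n * θ)
            - stdNormalPDF (Real.sqrt τ + Real.sqrt n * θ))
        - 2 * θ *
          (stdNormalCDF (Real.sqrt τ - Real.sqrt n * θ)
            - stdNormalCDF (-Real.sqrt τ - Real.sqrt n * θ))) θ := by
  have hs : 0 < √n := Real.sqrt_pos.2 hn
  have hr : 0 < √τ := Real.sqrt_pos.2 hτ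
  have hB : biasFn n τ = fun m ↦
      (truncatedPrimitive √τ √n m (√τ - √n * m) - truncatedPrimitive √τ √n m (-√τ - √n * m))
        + ((Real.toNNReal (1 / n) : ℝ) - τ / n
          - ∫ x, max (x ^ 2 - τ / n) 0 ∂(gaussianReal 0 (Real.toNNReal (1 / n)))) := by
    ext m
    have h := integral_truncated_gaussianReal hr hs m
    rw [Real.sq_sqrt hn.le, Real.sq_sqrt hτ.le] at h
    rw [← h, biasFn, integral_max_sq_sub_gaussianReal (τ / n) m]
    ring
  rw [hB]
  refine (((hasDerivAt_truncatedPrimitive_comp √τ √n √τ hs rfl θ).sub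
    (hasDerivAt_truncatedPrimitive_comp √τ √n (-√τ) hs (neg_sq _) θ)).add_const _).congr_deriv ?_
  rw [show -√τ - √n * θ = -(√τ + √n * θ) by ring, stdNormalPDF_neg]
  ring
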